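/- arXiv:1606.06617 — 3 statements merged into one kernel-verified Lean document; each statement's English description precedes it below -/
import Mathlib

section
/- Let S be a string of length n = z·2^L over a finite alphabet, with z ≥ 1 and L ≥ 0. Then for every position i and every length m ≥ 2 with 1 ≤ i and i + m − 1 ≤ n, at least one of the following holds: (a) there exist a level l ∈ {0,…,L} and an index j such that blocks (l,j) and (l,j+1) are both explicit and the interval [i, i+m−1] overlaps both of them, i.e. i ≤ j·b_l and j·b_l + 1 ≤ i + m − 1; or (b) there exist a level l and an index j such that block (l,j) is explicit and unmarked and [i, i+m−1] ⊆ [(j−1)·b_l + 1, j·b_l]. (In particular, every occurrence of a string P of length at least 2 in S either overlaps two explicit blocks at some level, or is completely inside an unmarked block at some level.) -/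
/-- Block Tree explicitness: a block `(l, j)` (level `l`, index `j`, `1`-based) is
explicit if `l = 0`, or if its parent block `(l-1, ⌈j/2⌉)` is explicit and marked. -/
def BTexplicit (marked : ℕ → ℕ → Prop) : ℕ → ℕ → Prop
  | 0, _ => True
  | l + 1, j => BTexplicit marked l ((j + 1) / 2) ∧ marked l ((j + 1) / 2)

/-- An interval `[i, e]` with at least two positions contained in the explicit block `(l, k + 1)`
crosses two consecutive explicit blocks or lies inside an explicit unmarked block. -/
theorem BTexplicit.crosses_or_inside_unmarked (marked : ℕ → ℕ → Prop) (z L i e : ℕ) (hie : i < e)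
    (d l k : ℕ) (hd : l + d = L) (hk : k + 1 ≤ z * 2 ^ l) (hex : BTexplicit marked l (k + 1))
    (hik : k * 2 ^ d + 1 ≤ i) (hek : e ≤ (k + 1) * 2 ^ d) :
    (∃ l ≤ L, ∃ j, 1 ≤ j ∧ j + 1 ≤ z * 2 ^ l ∧
      BTexplicit marked l j ∧ BTexplicit marked l (j + 1) ∧
      i ≤ j * 2 ^ (L - l) ∧ j * 2 ^ (L - l) + 1 ≤ e) ∨
    (∃ l ≤ L, ∃ j, 1 ≤ j ∧ j ≤ z * 2 ^ l ∧
      BTexplicit marked l j ∧ ¬ marked l j ∧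
      (j - 1) * 2 ^ (L - l) + 1 ≤ i ∧ e ≤ j * 2 ^ (L - l)) := by
  induction d generalizing l k with
  | zero => simp only [pow_zero] at hik hek; omega
  | succ d ih =>
    by_cases hm : marked l (k + 1)
    · have hleft : BTexplicit marked (l + 1) (2 * k + 1) := by
        have h : (2 * k + 1 + 1) / 2 = k + 1 := by omega
        simpa only [BTexplicit, h] using And.intro hex hm
      have hright : BTexplicit marked (l + 1) (2 * k + 1 + 1) := by
        have h : (2 * k + 1 + 1 + 1) / 2 = k + 1 := by omega
        simpa only [BTexplicit, h] using And.intro hex hm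
      have hz : 2 * k + 1 + 1 ≤ z * 2 ^ (l + 1) := by rw [pow_succ]; lia
      have hik' : 2 * k * 2 ^ d + 1 ≤ i := by rw [pow_succ] at hik; lia
      have hek' : e ≤ (2 * k + 1 + 1) * 2 ^ d := by rw [pow_succ] at hek; lia
      by_cases he : e ≤ (2 * k + 1) * 2 ^ d
      · exact ih (l + 1) (2 * k) (by omega) (by omega) hleft hik' he
      by_cases hi : (2 * k + 1) * 2 ^ d + 1 ≤ i
      · exact ih (l + 1) (2 * k + 1) (by omega) hz hright hi hek'
      have hL : L - (l + 1) = d := by omega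
      refine .inl ⟨l + 1, by omega, 2 * k + 1, by omega, hz, hleft, hright, ?_, ?_⟩ <;>
        rw [hL] <;> omega
    · have hL : L - l = d + 1 := by omega
      refine .inr ⟨l, by omega, k + 1, by omega, hk, hex, hm, ?_, ?_⟩
      · simpa only [hL, Nat.add_sub_cancel] using hik
      · simpa only [hL] using hek

/-- Every occurrence (interval `[i, i+m-1]`, `m ≥ 2`) in a string `S` of length
`n = z·2^L` either overlaps two consecutive explicit blocks at some level, or is
completely inside an explicit unmarked block at some level.  Blocks at level `l`
have length `b_l = 2^(L-l)`, and block `(l, j)` spans `[(j-1)·b_l + 1, j·b_l]`. -/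
theorem blockTree_occurrence_crosses_or_inside_unmarked
    {α : Type*} [Fintype α] (z L n : ℕ) (hz : 1 ≤ z) (hn : n = z * 2 ^ L)
    (S : Fin n → α) (marked : ℕ → ℕ → Prop)
    (i m : ℕ) (hm : 2 ≤ m) (hi : 1 ≤ i) (him : i + m - 1 ≤ n) :
    (∃ l ≤ L, ∃ j, 1 ≤ j ∧ j + 1 ≤ z * 2 ^ l ∧
      BTexplicit marked l j ∧ BTexplicit marked l (j + 1) ∧
      i ≤ j * 2 ^ (L - l) ∧ j * 2 ^ (L - l) + 1 ≤ i + m - 1) ∨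
    (∃ l ≤ L, ∃ j, 1 ≤ j ∧ j ≤ z * 2 ^ l ∧
      BTexplicit marked l j ∧ ¬ marked l j ∧
      (j - 1) * 2 ^ (L - l) + 1 ≤ i ∧ i + m - 1 ≤ j * 2 ^ (L - l)) := by
  obtain ⟨k, hk⟩ : ∃ k, k = (i - 1) / 2 ^ L := ⟨_, rfl⟩
  have hpos : 0 < 2 ^ L := by positivity
  have hlow : k * 2 ^ L + 1 ≤ i := by
    have := Nat.div_mul_le_self (i - 1) (2 ^ L)
    rw [← hk] at this
    omega
  have hhigh : i ≤ (k + 1) * 2 ^ L := by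
    have := Nat.lt_mul_of_div_lt (hk ▸ Nat.lt_succ_self k : (i - 1) / 2 ^ L < k + 1) hpos
    rw [mul_comm] at this
    lia
  have hkz : k < z := Nat.lt_of_mul_lt_mul_right (a := 2 ^ L) (by omega)
  by_cases he : i + m - 1 ≤ (k + 1) * 2 ^ L
  · exact BTexplicit.crosses_or_inside_unmarked marked z L i (i + m - 1) (by omega) L 0 k
      (by omega) (by simpa using hkz) trivial hlow he
  · have hkz' : k + 1 < z := Nat.lt_of_mul_lt_mul_right (a := 2 ^ L) (by omega)
    refine .inl ⟨0, by omega, k + 1, by omega, by simpa using hkz', trivial, trivial, ?_, ?_⟩ <;>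
      rw [Nat.sub_zero] <;> omega
end

section
/- Let S be a string of length n = z·2^L over a finite alphabet with the Block Tree setup, and suppose that for every explicit unmarked block (l,j) a source position k_{l,j} is given satisfying 1 ≤ k_{l,j}, k_{l,j} + b_l ≤ (j−1)·b_l + 1 (the source interval lies strictly before the block), and S[k_{l,j} .. k_{l,j} + b_l − 1] = B_{l,j}. Fix a pattern P of length m ≥ 2, and let Found be the smallest set of positions that (i) contains every primary occurrence of P, and (ii) is closed under the rule: if i ∈ Found and (l,j) is an explicit unmarked block with [i, i+m−1] ⊆ [k_{l,j}, k_{l,j} + b_l − 1], then (j−1)·b_l + 1 + (i − k_{l,j}) ∈ Found. Then Found equals the set of all occurrences of P in S, i.e. Found = { i : 1 ≤ i, i+m−1 ≤ n, S[i .. i+m−1] = P }. (The described method correctly identifies all occurrences of P in S.) -/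
/-- `BTFound primary copyRule` is the smallest set of positions that contains every
primary occurrence and is closed under the copying rule. -/
inductive BTFound (primary : ℕ → Prop) (copyRule : ℕ → ℕ → Prop) : ℕ → Prop
  | base {i : ℕ} : primary i → BTFound primary copyRule i
  | step {i i' : ℕ} : BTFound primary copyRule i → copyRule i i' →
      BTFound primary copyRule i'

/-- An interval `[i, e]` of at least two positions either overlaps two consecutive explicit
blocks, or lies inside an explicit unmarked block. -/
theorem BTexplicit.overlap_or_subset_unmarked (marked : ℕ → ℕ → Prop) {z L i e : ℕ}
    (hi : 1 ≤ i) (hie : i < e) (he : e ≤ z * 2 ^ L) :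
    (∃ l ≤ L, ∃ j, 1 ≤ j ∧ j + 1 ≤ z * 2 ^ l ∧
      BTexplicit marked l j ∧ BTexplicit marked l (j + 1) ∧
      i ≤ j * 2 ^ (L - l) ∧ j * 2 ^ (L - l) + 1 ≤ e) ∨
    (∃ l ≤ L, ∃ j, 1 ≤ j ∧ j ≤ z * 2 ^ l ∧ BTexplicit marked l j ∧ ¬ marked l j ∧
      (j - 1) * 2 ^ (L - l) + 1 ≤ i ∧ e ≤ j * 2 ^ (L - l)) := by
  by_contra! hcon
  obtain ⟨hsplit, hunmarked⟩ := hcon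
  have descend : ∀ l ≤ L, ∃ k, k + 1 ≤ z * 2 ^ l ∧ BTexplicit marked l (k + 1) ∧
      k * 2 ^ (L - l) + 1 ≤ i ∧ e ≤ (k + 1) * 2 ^ (L - l) := by
    intro l
    induction l with
    | zero =>
      intro _
      have hlow := Nat.div_mul_le_self (i - 1) (2 ^ L)
      have hhigh := Nat.lt_div_mul_add (a := i - 1) (Nat.two_pow_pos L)
      have hlt : (i - 1) / 2 ^ L < z := Nat.div_lt_of_lt_mul (by rw [mul_comm]; omega)
      refine ⟨(i - 1) / 2 ^ L, by simpa using hlt, trivial, by simpa using by omega, ?_⟩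
      by_contra! hover
      simp only [Nat.sub_zero] at hover
      have hnext : (i - 1) / 2 ^ L + 1 < z :=
        lt_of_mul_lt_mul_right (hover.trans_le he) (Nat.zero_le _)
      have hend := hsplit 0 (Nat.zero_le L) ((i - 1) / 2 ^ L + 1) (Nat.succ_pos _)
        (by simpa using hnext) trivial trivial
        (by simp only [Nat.sub_zero, add_mul, one_mul]; omega)
      simp only [Nat.sub_zero] at hend
      omega
    | succ l ih =>
      intro hl
      obtain ⟨k, hk, hexp, hstart, hend⟩ := ih (by omega)
      have hmarked : marked l (k + 1) := by
        by_contra hnot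
        exact absurd hend
          (hunmarked l (by omega) (k + 1) (by omega) hk hexp hnot (by simpa using hstart)).not_ge
      have hpow : 2 ^ (L - l) = 2 * 2 ^ (L - (l + 1)) := by
        rw [← pow_succ']
        congr 1
        omega
      have hcount : z * 2 ^ (l + 1) = 2 * (z * 2 ^ l) := by ring
      have hleft : BTexplicit marked (l + 1) (2 * k + 1) := by
        have : (2 * k + 1 + 1) / 2 = k + 1 := by omega
        simpa only [BTexplicit, this] using And.intro hexp hmarked
      have hright : BTexplicit marked (l + 1) (2 * k + 1 + 1) := by
        have : (2 * k + 1 + 1 + 1) / 2 = k + 1 := by omega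
        simpa only [BTexplicit, this] using And.intro hexp hmarked
      rw [hpow] at hstart hend
      by_cases hmid : e ≤ (2 * k + 1) * 2 ^ (L - (l + 1))
      · exact ⟨2 * k, by omega, hleft, by linarith, hmid⟩
      · refine ⟨2 * k + 1, by omega, hright, ?_, by linarith⟩
        by_contra! hi'
        have := hsplit (l + 1) hl (2 * k + 1) (by omega) (by omega) hleft hright (by omega)
        omega
  obtain ⟨k, -, -, hstart, hend⟩ := descend L le_rfl
  simp only [Nat.sub_self, pow_zero, mul_one] at hstart hend
  omega

/-- Correctness of the search method: the smallest set of positions containing all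
primary occurrences of `P` (occurrences overlapping two consecutive explicit blocks at
some level) and closed under the copying rule along sources of explicit unmarked blocks
is exactly the set of all occurrences of `P` in `S`.  Here `S` (1-based positions
`1..n`, `n = z·2^L`) is the string, blocks at level `l` have length `b_l = 2^(L-l)`,
block `(l,j)` spans `[(j-1)·b_l+1, j·b_l]`, and each explicit unmarked block `(l,j)`
has a source starting at `src l j`, lying strictly before the block, with the same
content.  The pattern `P` (1-based positions `1..m`) has length `m ≥ 2`. -/
theorem blockTree_found_eq_occurrences
    {α : Type*} [Fintype α] (z L n : ℕ) (hz : 1 ≤ z) (hn : n = z * 2 ^ L)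
    (S : ℕ → α) (marked : ℕ → ℕ → Prop) (src : ℕ → ℕ → ℕ)
    (hsrc : ∀ l j, l ≤ L → 1 ≤ j → j ≤ z * 2 ^ l →
      BTexplicit marked l j → ¬ marked l j →
      1 ≤ src l j ∧ src l j + 2 ^ (L - l) ≤ (j - 1) * 2 ^ (L - l) + 1 ∧
      ∀ t < 2 ^ (L - l), S (src l j + t) = S ((j - 1) * 2 ^ (L - l) + 1 + t))
    (m : ℕ) (hm : 2 ≤ m) (P : ℕ → α) :
    ∀ i : ℕ,
      BTFound
        (fun i => 1 ≤ i ∧ i + m - 1 ≤ n ∧ (∀ t < m, S (i + t) = P (t + 1)) ∧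
          ∃ l ≤ L, ∃ j, 1 ≤ j ∧ j + 1 ≤ z * 2 ^ l ∧
            BTexplicit marked l j ∧ BTexplicit marked l (j + 1) ∧
            i ≤ j * 2 ^ (L - l) ∧ j * 2 ^ (L - l) + 1 ≤ i + m - 1)
        (fun i i' => ∃ l ≤ L, ∃ j, 1 ≤ j ∧ j ≤ z * 2 ^ l ∧
          BTexplicit marked l j ∧ ¬ marked l j ∧
          src l j ≤ i ∧ i + m - 1 ≤ src l j + 2 ^ (L - l) - 1 ∧
          i' = (j - 1) * 2 ^ (L - l) + 1 + (i - src l j))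
        i
      ↔ (1 ≤ i ∧ i + m - 1 ≤ n ∧ ∀ t < m, S (i + t) = P (t + 1)) := by
  intro i
  constructor
  · intro hfound
    induction hfound with
    | base hprimary => exact ⟨hprimary.1, hprimary.2.1, hprimary.2.2.1⟩
    | @step i i' _ hcopy ih =>
      obtain ⟨l, hl, j, hj, hjz, hexp, hnot, hlow, hhigh, rfl⟩ := hcopy
      obtain ⟨-, -, hcontent⟩ := hsrc l j hl hj hjz hexp hnot
      obtain ⟨-, -, hocc⟩ := ih
      have hblock : (j - 1) * 2 ^ (L - l) + 2 ^ (L - l) ≤ n := by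
        calc (j - 1) * 2 ^ (L - l) + 2 ^ (L - l) = (j - 1 + 1) * 2 ^ (L - l) := by ring
          _ ≤ z * 2 ^ l * 2 ^ (L - l) := Nat.mul_le_mul_right _ (by omega)
          _ = n := by rw [hn, mul_assoc, ← pow_add, Nat.add_sub_cancel' hl]
      refine ⟨by omega, by omega, fun t ht => ?_⟩
      rw [← hocc t ht, add_assoc, ← hcontent (i - src l j + t) (by omega)]
      congr 1
      omega
  · induction i using Nat.strong_induction_on with
    | _ i ih =>
      rintro ⟨hi, hin, hocc⟩
      rcases BTexplicit.overlap_or_subset_unmarked marked (e := i + m - 1) hi (by omega)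
        (hn ▸ hin) with hoverlap | ⟨l, hl, j, hj, hjz, hexp, hnot, hstart, hend⟩
      · exact .base ⟨hi, hin, hocc, hoverlap⟩
      · obtain ⟨hpos, hbefore, hcontent⟩ := hsrc l j hl hj hjz hexp hnot
        have hblock : j * 2 ^ (L - l) = (j - 1) * 2 ^ (L - l) + 2 ^ (L - l) := by
          rw [← Nat.succ_mul, Nat.succ_eq_add_one, Nat.sub_add_cancel hj]
        have hlen := Nat.two_pow_pos (L - l)
        refine .step (ih (src l j + (i - ((j - 1) * 2 ^ (L - l) + 1))) (by omega)
          ⟨by omega, by omega, fun t ht => ?_⟩)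
          ⟨l, hl, j, hj, hjz, hexp, hnot, by omega, by omega, by omega⟩
        rw [← hocc t ht, add_assoc, hcontent _ (by omega)]
        congr 1
        omega
end

section
/- Let S be a string of length n = z·2^L over a finite alphabet with the Block Tree setup. Let i and m ≥ 2 satisfy 1 ≤ i and i + m − 1 ≤ n, and suppose that the interval [i, i+m−1] is contained in some explicit marked block but is not contained in any explicit unmarked block at any level. Then there exists exactly one explicit marked block (l,j), necessarily with l < L, such that [i, i+m−1] ⊆ [(j−1)·b_l + 1, j·b_l] and the interval overlaps both halves of that block, i.e. i ≤ (j−1)·b_l + b_{l+1} and i + m − 1 ≥ (j−1)·b_l + b_{l+1} + 1. (Each primary occurrence that is contained in some block spans a suffix of the left half and a prefix of the right half of the unique deepest marked block containing it; hence it is found at exactly one pair of the grid.) -/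
theorem block_contains_iff {b q a e : ℕ} (hb : 0 < b) (h : a ≤ e) :
    (q * b ≤ a ∧ e < (q + 1) * b) ↔ (a / b = q ∧ e / b = q) := by
  simp only [Nat.div_eq_iff hb, add_mul, one_mul]
  omega

theorem block_overlaps_halves_iff {c q a e : ℕ} (hc : 0 < c)
    (ha : q * (2 * c) ≤ a) (hae : a ≤ e) (he : e < (q + 1) * (2 * c)) :
    (a < q * (2 * c) + c ∧ q * (2 * c) + c ≤ e) ↔ a / c ≠ e / c := by
  constructor
  · rintro ⟨h₁, h₂⟩
    have h₃ : a / c < 2 * q + 1 := (Nat.div_lt_iff_lt_mul hc).2 (by linarith)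
    have h₄ : 2 * q + 1 ≤ e / c := (Nat.le_div_iff_mul_le hc).2 (by linarith)
    omega
  · intro h
    by_contra hcon
    apply h
    by_cases h₁ : a < q * (2 * c) + c
    · have h₂ : e < q * (2 * c) + c := by omega
      have := (block_contains_iff (q := 2 * q) hc hae).1 ⟨by linarith, by linarith⟩
      omega
    · have := (block_contains_iff (q := 2 * q + 1) hc hae).1 ⟨by linarith, by linarith⟩
      omega

theorem two_pow_sub_eq_two_mul {L l : ℕ} (hl : l < L) :
    2 ^ (L - l) = 2 * 2 ^ (L - l - 1) := by
  rw [← pow_succ']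
  congr 1
  omega

theorem div_two_pow_sub_succ_div_two {L l : ℕ} (hl : l < L) (a : ℕ) :
    a / 2 ^ (L - (l + 1)) / 2 = a / 2 ^ (L - l) := by
  rw [Nat.div_div_eq_div_mul, two_pow_sub_eq_two_mul hl, mul_comm, Nat.sub_sub]

theorem div_two_pow_sub_eq_of_le {L a e l l' : ℕ} (hl : l ≤ l') (hl' : l' ≤ L)
    (h : a / 2 ^ (L - l') = e / 2 ^ (L - l')) : a / 2 ^ (L - l) = e / 2 ^ (L - l) := by
  induction l', hl using Nat.le_induction with
  | base => exact h
  | succ k _ ih =>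
    apply ih (by omega)
    rw [← div_two_pow_sub_succ_div_two hl', ← div_two_pow_sub_succ_div_two hl', h]

/-- The blocks containing the interval `[a, e]` (`0`-based) and overlapped by it in both halves
are those at the last level where `a` and `e` share a block. -/
theorem contained_and_overlaps_iff {L l q a e : ℕ} (hl : l < L) (hae : a ≤ e) :
    (q * 2 ^ (L - l) ≤ a ∧ e < (q + 1) * 2 ^ (L - l) ∧
      a < q * 2 ^ (L - l) + 2 ^ (L - l - 1) ∧ q * 2 ^ (L - l) + 2 ^ (L - l - 1) ≤ e) ↔
    (a / 2 ^ (L - l) = q ∧ e / 2 ^ (L - l) = q ∧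
      a / 2 ^ (L - (l + 1)) ≠ e / 2 ^ (L - (l + 1))) := by
  rw [← and_assoc, ← and_assoc (b := e / _ = _),
    ← block_contains_iff (Nat.two_pow_pos _) hae, ← Nat.sub_sub]
  refine and_congr_right fun ⟨h₁, h₂⟩ => ?_
  rw [two_pow_sub_eq_two_mul hl] at h₁ h₂ ⊢
  exact block_overlaps_halves_iff (Nat.two_pow_pos _) h₁ hae h₂

/-- If an interval `[i, i+m-1]` (with `m ≥ 2`) is contained in some explicit marked
block but in no explicit unmarked block, then there is exactly one explicit marked
block `(l, j)` (necessarily with `l < L`) containing the interval such that the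
interval overlaps both halves of the block, i.e. it spans a suffix of the left half
and a prefix of the right half of the deepest marked block containing it.
Blocks at level `l` have length `b_l = 2^(L-l)`; block `(l,j)` spans
`[(j-1)·b_l + 1, j·b_l]` and its halves split at `(j-1)·b_l + b_{l+1}`. -/
theorem blockTree_unique_deepest_marked_block
    {α : Type*} [Fintype α] (z L n : ℕ) (hz : 1 ≤ z) (hn : n = z * 2 ^ L)
    (S : Fin n → α) (marked : ℕ → ℕ → Prop)
    (i m : ℕ) (hm : 2 ≤ m) (hi : 1 ≤ i) (him : i + m - 1 ≤ n)
    (hmarked : ∃ l ≤ L, ∃ j, 1 ≤ j ∧ j ≤ z * 2 ^ l ∧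
      BTexplicit marked l j ∧ marked l j ∧
      (j - 1) * 2 ^ (L - l) + 1 ≤ i ∧ i + m - 1 ≤ j * 2 ^ (L - l))
    (hunmarked : ∀ l ≤ L, ∀ j, 1 ≤ j → j ≤ z * 2 ^ l →
      BTexplicit marked l j →
      (j - 1) * 2 ^ (L - l) + 1 ≤ i → i + m - 1 ≤ j * 2 ^ (L - l) →
      marked l j) :
    ∃! p : ℕ × ℕ, p.1 < L ∧ 1 ≤ p.2 ∧ p.2 ≤ z * 2 ^ p.1 ∧
      BTexplicit marked p.1 p.2 ∧ marked p.1 p.2 ∧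
      (p.2 - 1) * 2 ^ (L - p.1) + 1 ≤ i ∧ i + m - 1 ≤ p.2 * 2 ^ (L - p.1) ∧
      i ≤ (p.2 - 1) * 2 ^ (L - p.1) + 2 ^ (L - p.1 - 1) ∧
      (p.2 - 1) * 2 ^ (L - p.1) + 2 ^ (L - p.1 - 1) + 1 ≤ i + m - 1 := by
  obtain ⟨a, rfl⟩ : ∃ a, i = a + 1 := ⟨i - 1, by omega⟩
  obtain ⟨e, he⟩ : ∃ e, a + 1 + m - 1 = e + 1 := ⟨a + m - 1, by omega⟩
  have hae : a < e := by omega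
  simp only [he, Nat.succ_le_iff, Nat.lt_add_one_iff] at hmarked hunmarked him ⊢
  have index_lt : ∀ l ≤ L, a / 2 ^ (L - l) < z * 2 ^ l := fun l hl => by
    rw [Nat.div_lt_iff_lt_mul (Nat.two_pow_pos _), mul_assoc, ← pow_add, Nat.add_sub_cancel' hl]
    omega
  have marked_of_explicit : ∀ l ≤ L, a / 2 ^ (L - l) = e / 2 ^ (L - l) →
      BTexplicit marked l (a / 2 ^ (L - l) + 1) → marked l (a / 2 ^ (L - l) + 1) := by
    intro l hl h hexp
    obtain ⟨h₁, h₂⟩ := (block_contains_iff (Nat.two_pow_pos _) hae.le).2 ⟨rfl, h.symm⟩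
    exact hunmarked l hl _ (Nat.succ_pos _) (index_lt l hl) hexp h₁ h₂
  have explicit : ∀ l ≤ L, a / 2 ^ (L - l) = e / 2 ^ (L - l) →
      BTexplicit marked l (a / 2 ^ (L - l) + 1) := by
    intro l
    induction l with
    | zero => intros; trivial
    | succ l ih =>
      intro hl h
      have hpar := div_two_pow_sub_eq_of_le (Nat.le_succ l) hl h
      have hidx : (a / 2 ^ (L - (l + 1)) + 1 + 1) / 2 = a / 2 ^ (L - l) + 1 := by
        rw [← div_two_pow_sub_succ_div_two hl]
        omega
      rw [BTexplicit, hidx]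
      have hexp := ih (by omega) hpar
      exact ⟨hexp, marked_of_explicit l (by omega) hpar hexp⟩
  obtain ⟨l₀, hl₀, j₀, hj₀, -, -, -, h₁, h₂⟩ := hmarked
  obtain ⟨q₀, rfl⟩ : ∃ q, j₀ = q + 1 := ⟨j₀ - 1, by omega⟩
  obtain ⟨h₁, h₂⟩ := (block_contains_iff (Nat.two_pow_pos _) hae.le).1 ⟨h₁, h₂⟩
  have hzero := div_two_pow_sub_eq_of_le (Nat.zero_le l₀) hl₀ (h₁.trans h₂.symm)
  obtain ⟨l, hl, hsame, hsplit⟩ : ∃ l < L, a / 2 ^ (L - l) = e / 2 ^ (L - l) ∧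
      a / 2 ^ (L - (l + 1)) ≠ e / 2 ^ (L - (l + 1)) := by
    by_contra! hcon
    have hall : ∀ l ≤ L, a / 2 ^ (L - l) = e / 2 ^ (L - l) := by
      intro l
      induction l with
      | zero => exact fun _ => hzero
      | succ l ih => exact fun hl => hcon l hl (ih (by omega))
    have := hall L le_rfl
    simp at this
    omega
  refine ⟨(l, a / 2 ^ (L - l) + 1), ⟨hl, Nat.succ_pos _, index_lt l hl.le,
    explicit l hl.le hsame, marked_of_explicit l hl.le hsame (explicit l hl.le hsame),
    (contained_and_overlaps_iff hl hae.le).2 ⟨rfl, hsame.symm, hsplit⟩⟩, ?_⟩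
  rintro ⟨l', j'⟩ ⟨hl', hj', -, -, -, h⟩
  dsimp only at hl' hj' h
  obtain ⟨q, rfl⟩ : ∃ q, j' = q + 1 := ⟨j' - 1, by omega⟩
  obtain ⟨ha, he', hsplit'⟩ := (contained_and_overlaps_iff hl' hae.le).1 h
  obtain rfl : l' = l := by
    rcases lt_trichotomy l' l with hlt | heq | hlt
    · exact absurd (div_two_pow_sub_eq_of_le hlt hl.le hsame) hsplit'
    · exact heq
    · exact absurd (div_two_pow_sub_eq_of_le hlt hl'.le (ha.trans he'.symm)) hsplit
  rw [ha, Nat.add_sub_cancel]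
end
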